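/- Let λ > 1, γ = 1/(λ−1), let D_1, D_2, … be i.i.d. Poisson(λ) random variables, set S_i = (Σ_{j=1}^i D_j) − (i−1), and let E_1, E_2, … be i.i.d. rate-1 exponential random variables independent of (D_i). On the survival event {S_i > 0 for all i ≥ 1}, define A_m = Σ_{i=1}^m E_i/S_i (the time of the m-th split of the continuous-time branching process). Then, on the survival event, A_m − γ·log m converges almost surely as m→∞ to an almost surely finite random variable; this limit equals −γ·log(γ·W_λ), where W_λ is distributed as the (strictly positive) almost sure limit of e^{−(λ−1)t}·N(t) conditioned on non-extinction, N(t) being the number of alive individuals at time t in a continuous-time branching process with Poisson(λ) offspring and rate-1 exponential lifetimes. -/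

import Mathlib

open MeasureTheory ProbabilityTheory Filter Real
open scoped ENNReal NNReal

noncomputable section

/-- The Poisson distribution with parameter `l` on `ℕ`. -/
def poissonDist (l : ℝ) : Measure ℕ :=
  Measure.count.withDensity (fun n => ENNReal.ofReal (Real.exp (-l) * l ^ n / n.factorial))

/-- The exponential distribution with rate 1 on `ℝ`. -/
def expDist : Measure ℝ :=
  volume.withDensity (fun x => if 0 ≤ x then ENNReal.ofReal (Real.exp (-x)) else 0)

/-- weight `n^{-3/2}` -/
def wt (n : ℕ) : ℝ := (n : ℝ) ^ (-(3/2 : ℝ))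

lemma wt_nonneg (n : ℕ) : 0 ≤ wt n := by unfold wt; positivity

lemma wt_summable : Summable wt := by
  unfold wt
  exact Real.summable_nat_rpow.2 (by norm_num)

lemma wt_sq (n : ℕ) (hn : 1 ≤ n) : wt n * wt n = 1 / (n:ℝ)^3 := by
  unfold wt
  have : (0:ℝ) < n := by exact_mod_cast hn
  rw [← Real.rpow_add this, one_div, ← Real.rpow_natCast, ← Real.rpow_neg this.le]
  norm_num

lemma inv_sq_le_wt (n : ℕ) (hn : 1 ≤ n) : 1 / (n:ℝ)^2 ≤ wt n := by
  have h1 : (1:ℝ) ≤ n := by exact_mod_cast hn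
  unfold wt
  rw [one_div, ← Real.rpow_natCast, ← Real.rpow_neg (by positivity)]
  exact Real.rpow_le_rpow_of_exponent_le h1 (by norm_num)

lemma amgm_wt (n : ℕ) (hn : 1 ≤ n) (t x : ℝ) :
    |t| * |x| / (n:ℝ)^2 ≤ t^2 / n * wt n + x^2 * wt n := by
  have h0 : (0:ℝ) < n := by exact_mod_cast hn
  have hw := wt_nonneg n
  have hs := wt_sq n hn
  have h1 : (0:ℝ) ≤ t^2 / n * wt n + x^2 * wt n := by positivity
  apply le_of_sq_le_sq _ h1
  have e : (|t| * |x| / (n:ℝ)^2)^2 = (t^2 / n) * x^2 * (wt n * wt n) := by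
    rw [hs, div_pow, mul_pow, sq_abs, sq_abs]; field_simp
  rw [e]
  have : 0 ≤ t^2/n * wt n := by positivity
  have : 0 ≤ x^2 * wt n := by positivity
  nlinarith [mul_nonneg ‹0 ≤ t^2/n * wt n› this]

lemma det_part (lam : ℝ) (hlam : 1 < lam) (d e s Td Te A : ℕ → ℝ)
    (hTd : ∀ n, Td n = ∑ i ∈ Finset.range n, d i - n * lam)
    (hTe : ∀ n, Te n = ∑ i ∈ Finset.range n, e i - n * 1)
    (hs : ∀ n, s n = ∑ i ∈ Finset.range n, d i - (n - 1))
    (hA : ∀ n, A n = ∑ i ∈ Finset.range n, e i / s (i + 1))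
    (ld : Tendsto (fun n : ℕ => (∑ i ∈ Finset.range n, d i) / n) atTop (nhds lam))
    (le : Tendsto (fun n : ℕ => (∑ i ∈ Finset.range n, e i) / n) atTop (nhds 1))
    (sd : Summable fun n : ℕ => Td n ^ 2 / n * wt n)
    (se : Summable fun n : ℕ => Te n ^ 2 / n * wt n)
    (sx : Summable fun n : ℕ => d n ^ 2 * wt n) :
    ∃ w : ℝ, 0 < w ∧
        Tendsto (fun m : ℕ => Real.exp (-(lam - 1) * A m) * s (m + 1)) atTop (nhds w) ∧
        Tendsto (fun m : ℕ => A m - 1 / (lam - 1) * Real.log m)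
          atTop (nhds (-(1 / (lam - 1)) * Real.log (1 / (lam - 1) * w))) := by
  have ha : 0 < lam - 1 := by linarith
  set a := lam - 1 with ha'
  have hlim : Tendsto (fun n : ℕ => s n / n) atTop (nhds a) := by
    have h1 : Tendsto (fun n : ℕ => (∑ i ∈ Finset.range n, d i) / n - (1 - (1:ℝ) / n))
        atTop (nhds (lam - (1 - 0))) :=
      ld.sub (tendsto_const_nhds.sub tendsto_one_div_atTop_nhds_zero_nat)
    rw [sub_zero] at h1
    refine h1.congr' ?_
    filter_upwards [eventually_ge_atTop 1] with n hn
    have h0 : (0:ℝ) < n := by exact_mod_cast hn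
    rw [hs]; field_simp
  set c := a / 2 with hc
  have hc0 : 0 < c := by positivity
  have hlow : ∀ᶠ n : ℕ in atTop, c * n ≤ s n := by
    filter_upwards [hlim.eventually (lt_mem_nhds (show c < a by linarith)),
      eventually_ge_atTop 1] with n h hn
    have h0 : (0:ℝ) < n := by exact_mod_cast hn
    rw [lt_div_iff₀ h0] at h
    exact h.le
  -- first series
  have S1 : Summable fun n : ℕ => Te n * (1 / s n - 1 / s (n + 1)) := by
    have hb : Summable fun n : ℕ => (1 / c^2) * (Te n ^ 2 / n * wt n
        + (2 * (d n ^ 2 * wt n) + 2 * wt n)) :=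
      (se.add ((sx.mul_left 2).add (wt_summable.mul_left 2))).mul_left _
    refine Summable.of_norm_bounded_eventually_nat hb ?_
    filter_upwards [hlow, (tendsto_add_atTop_nat 1).eventually hlow, eventually_ge_atTop 1]
      with n h1 h2 hn
    have h0 : (0:ℝ) < n := by exact_mod_cast hn
    have hp1 : 0 < s n := lt_of_lt_of_le (by positivity) h1
    have h2' : c * n ≤ s (n+1) := by
      refine le_trans ?_ h2
      push_cast; nlinarith
    have hp2 : 0 < s (n+1) := lt_of_lt_of_le (by positivity) h2'
    have e1 : Te n * (1 / s n - 1 / s (n + 1)) = Te n * (d n - 1) / (s n * s (n+1)) := by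
      have : s (n+1) = s n + (d n - 1) := by
        rw [hs, hs, Finset.sum_range_succ]; push_cast; ring
      have e0 : d n - 1 = s (n+1) - s n := by linarith
      rw [e0]
      field_simp
    rw [e1, Real.norm_eq_abs, abs_div, abs_mul, abs_of_pos (mul_pos hp1 hp2)]
    have h3 : c^2 * (n:ℝ)^2 ≤ s n * s (n+1) := by
      calc c^2 * (n:ℝ)^2 = (c * n) * (c * n) := by ring
        _ ≤ _ := mul_le_mul h1 h2' (by positivity) hp1.le
    calc |Te n| * |d n - 1| / (s n * s (n+1)) ≤ |Te n| * |d n - 1| / (c^2 * (n:ℝ)^2) := by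
          gcongr
      _ = (1/c^2) * (|Te n| * |d n - 1| / (n:ℝ)^2) := by field_simp
      _ ≤ (1/c^2) * (Te n ^ 2 / n * wt n + (d n - 1)^2 * wt n) := by
          gcongr; exact amgm_wt n hn _ _
      _ ≤ _ := by
          have hw := wt_nonneg n
          have : (d n - 1)^2 ≤ 2 * d n ^2 + 2 := by nlinarith [sq_nonneg (d n + 1)]
          have := mul_le_mul_of_nonneg_right this hw
          gcongr
          linarith
  have S2 : Summable fun n : ℕ => 1 / s n - 1 / (a * n) := by
    have hb : Summable fun n : ℕ => (1 / (c * a)) * ((Td n ^ 2 / n * wt n + wt n) + wt n) :=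
      ((sd.add wt_summable).add wt_summable).mul_left _
    refine Summable.of_norm_bounded_eventually_nat hb ?_
    filter_upwards [hlow, eventually_ge_atTop 1] with n h1 hn
    have h0 : (0:ℝ) < n := by exact_mod_cast hn
    have hp1 : 0 < s n := lt_of_lt_of_le (by positivity) h1
    have e1 : 1 / s n - 1 / (a * n) = -(Td n + 1) / (s n * (a * n)) := by
      have e0 : Td n + 1 = s n - a * n := by rw [hTd, hs, ha']; ring
      rw [e0]; field_simp; ring
    rw [e1, Real.norm_eq_abs, abs_div, abs_neg, abs_of_pos (show 0 < s n * (a * n) by positivity)]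
    have h3 : c * a * (n:ℝ)^2 ≤ s n * (a * n) := by
      calc c * a * (n:ℝ)^2 = (c * n) * (a * n) := by ring
        _ ≤ _ := by gcongr
    have h4 := amgm_wt n hn (Td n) 1
    have h5 := inv_sq_le_wt n hn
    calc |Td n + 1| / (s n * (a * n)) ≤ (|Td n| + 1) / (c * a * (n:ℝ)^2) := by
          gcongr
          simpa using abs_add_le (Td n) 1
      _ = (1/(c*a)) * (|Td n| * |1| / (n:ℝ)^2 + 1 / (n:ℝ)^2) := by
          rw [abs_one]; field_simp
      _ ≤ _ := by
          gcongr
          simpa using h4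
  have S2' := (summable_nat_add_iff 1).2 S2
  have T1 := S1.hasSum.tendsto_sum_nat
  have T2 := S2'.hasSum.tendsto_sum_nat
  have T3 := Real.tendsto_harmonic_sub_log
  have T4 : Tendsto (fun n : ℕ => Te n / s n) atTop (nhds 0) := by
    have h1 : Tendsto (fun n : ℕ => ((∑ i ∈ Finset.range n, e i) / n - 1) / (s n / n)) atTop
      (nhds ((1 - 1) / a)) := (le.sub_const 1).div hlim ha.ne'
    rw [sub_self, zero_div] at h1
    refine h1.congr' ?_
    filter_upwards [eventually_ge_atTop 1] with n hn
    have h0 : (0:ℝ) < n := by exact_mod_cast hn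
    rw [hTe]
    rw [show (∑ i ∈ Finset.range n, e i) / n - 1 = (∑ i ∈ Finset.range n, e i - n * 1) / n by
      field_simp]
    rw [div_div_div_cancel_right₀ h0.ne']
  obtain ⟨Lm, hL⟩ : ∃ Lm, Tendsto (fun m : ℕ => A m - 1 / a * Real.log m) atTop (nhds Lm) := by
    refine ⟨_, (((T4.add T1).add T2).add (T3.const_mul (1/a))).congr ?_⟩
    intro m
    have abel : ∀ m, ∑ i ∈ Finset.range m, (e i - 1) / s (i+1) =
        Te m / s m + ∑ i ∈ Finset.range m, Te i * (1 / s i - 1 / s (i+1)) := by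
      intro m
      induction m with
      | zero => simp [hTe]
      | succ k ih =>
        rw [Finset.sum_range_succ, Finset.sum_range_succ, ih]
        have : Te (k+1) = Te k + (e k - 1) := by
          rw [hTe, hTe, Finset.sum_range_succ]; push_cast; ring
        rw [this]; ring
    rw [← abel, hA]
    have hh : ((harmonic m : ℚ) : ℝ) = ∑ i ∈ Finset.range m, 1 / ((i + 1 : ℕ) : ℝ) := by
      simp [harmonic]
    rw [hh, mul_sub, Finset.mul_sum, ← add_sub_assoc, ← Finset.sum_add_distrib,
      ← Finset.sum_add_distrib]
    congr 1
    apply Finset.sum_congr rfl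
    intro i _
    rw [one_div_mul_one_div]
    ring
  refine ⟨Real.exp (-a * Lm) * a, by positivity, ?_, ?_⟩
  · have h1 : Tendsto (fun m : ℕ => Real.exp (-a * (A m - 1 / a * Real.log m)) *
      (s (m+1) / ((m + 1 : ℕ):ℝ) * ((((m:ℕ):ℝ) + 1) / ((m:ℕ):ℝ)))) atTop
        (nhds (Real.exp (-a * Lm) * (a * 1))) := by
      refine ((Real.continuous_exp.tendsto _).comp (hL.const_mul (-a))).mul
        (((tendsto_add_atTop_iff_nat 1).2 hlim).mul ?_)
      have : Tendsto (fun m : ℕ => 1 + 1 / (m:ℝ)) atTop (nhds (1 + 0)) :=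
        tendsto_const_nhds.add tendsto_one_div_atTop_nhds_zero_nat
      rw [add_zero] at this
      refine this.congr' ?_
      filter_upwards [eventually_ge_atTop 1] with n hn
      have h0 : (0:ℝ) < n := by exact_mod_cast hn
      field_simp
    rw [mul_one] at h1
    refine h1.congr' ?_
    filter_upwards [eventually_ge_atTop 1] with n hn
    have h0 : (0:ℝ) < n := by exact_mod_cast hn
    have : Real.exp (-a * (A n - 1 / a * Real.log n)) = Real.exp (-a * A n) * n := by
      rw [show -a * (A n - 1 / a * Real.log n) = -a * A n + Real.log n by field_simp; ring,
        Real.exp_add, Real.exp_log h0]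
    rw [this]; push_cast; field_simp
  · convert hL using 2
    rw [show 1 / a * (Real.exp (-a * Lm) * a) = Real.exp (-a * Lm) by field_simp, Real.log_exp]
    field_simp

lemma summable_of_bdd {Ω : Type} [MeasurableSpace Ω] (μ : Measure Ω)
    (Z : ℕ → Ω → ℝ) (hZ : ∀ n ω, 0 ≤ Z n ω) (hint : ∀ n, Integrable (Z n) μ)
    (C : ℝ) (hC : ∀ n, ∫ ω, Z n ω ∂μ ≤ C) :
    ∀ᵐ ω ∂μ, Summable fun n => Z n ω * wt n := by
  have hC0 : 0 ≤ C := (integral_nonneg (hZ 0)).trans (hC 0)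
  have hfin : ∫⁻ ω, ∑' n, ENNReal.ofReal (Z n ω * wt n) ∂μ ≠ ∞ := by
    rw [lintegral_tsum (fun n => ((hint n).aemeasurable.mul_const _).ennreal_ofReal)]
    have : ∀ n, ∫⁻ ω, ENNReal.ofReal (Z n ω * wt n) ∂μ ≤ ENNReal.ofReal (C * wt n) := by
      intro n
      rw [← ofReal_integral_eq_lintegral_ofReal ((hint n).mul_const _)
        (ae_of_all _ fun ω => mul_nonneg (hZ n ω) (wt_nonneg n)), integral_mul_const]
      exact ENNReal.ofReal_le_ofReal (mul_le_mul_of_nonneg_right (hC n) (wt_nonneg n))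
    refine ne_top_of_le_ne_top ?_ (ENNReal.tsum_le_tsum this)
    exact (wt_summable.mul_left C).tsum_ofReal_ne_top
  have hm : AEMeasurable (fun ω => ∑' n, ENNReal.ofReal (Z n ω * wt n)) μ :=
    AEMeasurable.tsum fun n => ((hint n).aemeasurable.mul_const _).ennreal_ofReal
  filter_upwards [ae_lt_top' hm hfin] with ω h
  have := ENNReal.summable_toReal h.ne
  refine this.congr fun n => ?_
  rw [ENNReal.toReal_ofReal (mul_nonneg (hZ n ω) (wt_nonneg n))]

lemma iid_part {Ω : Type} [MeasurableSpace Ω] (μ : Measure Ω) [IsProbabilityMeasure μ]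
    (X : ℕ → Ω → ℝ) (hL2 : MemLp (X 0) 2 μ) (hind : iIndepFun X μ)
    (hid : ∀ i, IdentDistrib (X i) (X 0) μ μ) (c : ℝ) (hc : ∫ ω, X 0 ω ∂μ = c) :
    ∀ᵐ ω ∂μ, Tendsto (fun n : ℕ => (∑ i ∈ Finset.range n, X i ω) / n) atTop (nhds c) ∧
      (Summable fun n : ℕ => (∑ i ∈ Finset.range n, X i ω - n * c) ^ 2 / n * wt n) ∧
      (Summable fun n : ℕ => X n ω ^ 2 * wt n) := by
  have hmem : ∀ i, MemLp (X i) 2 μ := fun i => (hid i).symm.memLp_iff.1 hL2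
  have hpair : Pairwise (Function.onFun (fun f g => IndepFun f g μ) X) :=
    fun i j hij => hind.indepFun hij
  have h1 := strong_law_ae_real X (hL2.integrable (by norm_num)) hpair hid
  rw [hc] at h1
  have hsumL : ∀ n : ℕ, MemLp (∑ i ∈ Finset.range n, X i) 2 μ := fun n =>
    memLp_finsetSum' _ fun i _ => hmem i
  have hmean : ∀ n : ℕ, ∫ ω, (∑ i ∈ Finset.range n, X i) ω ∂μ = n * c := by
    intro n
    simp only [Finset.sum_apply]
    rw [integral_finsetSum _ fun i _ => (hmem i).integrable (by norm_num)]
    simp [(hid _).integral_eq, hc]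
  have h2 := summable_of_bdd μ
    (fun n ω => (∑ i ∈ Finset.range n, X i ω - n * c) ^ 2 / n)
    (fun n ω => by positivity)
    (fun n => by
      have := ((hsumL n).sub (memLp_const (n * c))).integrable_sq.div_const (n:ℝ)
      simpa using this)
    (variance (X 0) μ) (fun n => by
      have hv := IndepFun.variance_sum (s := Finset.range n) (fun i _ => hmem i)
        (fun i _ j _ hij => hpair hij)
      rw [variance_eq_integral (hsumL n).aemeasurable, hmean] at hv
      simp only [Finset.sum_apply, (hid _).variance_eq, Finset.sum_const, Finset.card_range,
        nsmul_eq_mul] at hv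
      rw [integral_div, hv]
      rcases Nat.eq_zero_or_pos n with h | h
      · subst h; simp [variance_nonneg]
      · have : (0:ℝ) < n := by exact_mod_cast h
        field_simp; rfl)
  have h3 := summable_of_bdd μ (fun n ω => X n ω ^ 2) (fun n ω => by positivity)
    (fun n => (hmem n).integrable_sq) (∫ ω, X 0 ω ^ 2 ∂μ) (fun n =>
      ((hid n).comp (u := fun x : ℝ => x ^ 2) (by fun_prop)).integral_eq.le)
  filter_upwards [h1, h2, h3] with ω a b c using ⟨a, b, c⟩

lemma poissonDist_eq (l : ℝ≥0) : poissonDist l = poissonMeasure l := by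
  refine Measure.ext_of_singleton fun n => ?_
  rw [poissonMeasure_singleton, poissonDist, withDensity_apply _ (by measurability)]
  simp

lemma poisson_sq (l : ℝ≥0) : Integrable (fun n : ℕ => (n:ℝ)^2) (poissonMeasure l) := by
  rw [integrable_poissonMeasure_iff]
  rw [← summable_nat_add_iff 2]
  have h := (Real.summable_pow_div_factorial (l:ℝ)).mul_left (4 * exp (-l) * (l:ℝ)^2)
  refine Summable.of_nonneg_of_le (fun n => by positivity) (fun n => ?_) h
  rw [Real.norm_of_nonneg (by positivity), Nat.factorial_succ, Nat.factorial_succ]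
  push_cast
  have h1 : ((n:ℝ)+2)^2 ≤ 4 * (((n:ℝ)+1+1) * (n+1)) := by
    have : (0:ℝ) ≤ n := by positivity
    nlinarith
  rw [div_mul_eq_mul_div, mul_div_assoc', div_le_div_iff₀ (by positivity) (by positivity)]
  have h2 : 0 ≤ exp (-l) * (l:ℝ)^2 * (l:ℝ)^n * (n.factorial:ℝ) := by positivity
  calc _ = exp (-l) * (l:ℝ)^2 * (l:ℝ)^n * (n.factorial:ℝ) * ((n:ℝ)+2)^2 := by ring
    _ ≤ exp (-l) * (l:ℝ)^2 * (l:ℝ)^n * (n.factorial:ℝ) * (4 * (((n:ℝ)+1+1) * (n+1))) := by gcongr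
    _ = _ := by ring

lemma poisson_memLp (l : ℝ≥0) : MemLp (fun n : ℕ => (n:ℝ)) 2 (poissonMeasure l) :=
  (memLp_two_iff_integrable_sq (by fun_prop)).2 (poisson_sq l)

lemma poisson_mean (l : ℝ≥0) : ∫ n, (n:ℝ) ∂(poissonMeasure l) = l := by
  have h := hasSum_integral_poissonMeasure ((poisson_memLp l).integrable (by norm_num))
  rw [← hasSum_nat_add_iff' 1] at h
  have h2 := (hasSum_one_poissonMeasure l).mul_left (l:ℝ)
  have e : (fun n : ℕ => (exp (-l) * (l:ℝ) ^ (n + 1) / ((n + 1).factorial : ℝ)) • ((n + 1 : ℕ) : ℝ))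
      = fun n : ℕ => (l:ℝ) * (exp (-l) * (l:ℝ) ^ n / (n.factorial : ℝ)) := by
    ext n
    rw [Nat.factorial_succ, smul_eq_mul]; push_cast; field_simp; ring
  rw [e] at h
  simpa using h.unique h2

lemma expDist_eq : expDist = (volume.restrict (Set.Ioi 0)).withDensity
    (fun x => ENNReal.ofReal (Real.exp (-x))) := by
  rw [expDist, Measure.restrict_congr_set (Ioi_ae_eq_Ici (a := (0:ℝ)) (μ := volume)), ← withDensity_indicator measurableSet_Ici]
  congr 1

lemma expDist_integrable_iff (f : ℝ → ℝ) : Integrable f expDist ↔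
    IntegrableOn (fun x => Real.exp (-x) * f x) (Set.Ioi 0) := by
  rw [expDist_eq, integrable_withDensity_iff_integrable_smul₀' (by fun_prop) (by simp)]
  simp [ENNReal.toReal_ofReal, Real.exp_nonneg, IntegrableOn]

lemma expDist_integral (f : ℝ → ℝ) : ∫ x, f x ∂expDist =
    ∫ x in Set.Ioi 0, Real.exp (-x) * f x := by
  rw [expDist_eq, integral_withDensity_eq_integral_toReal_smul (by fun_prop) (by simp)]
  simp [ENNReal.toReal_ofReal, Real.exp_nonneg]

instance : IsProbabilityMeasure expDist := by
  have : expDist = expMeasure 1 := by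
    rw [expDist, expMeasure, gammaMeasure]
    congr 1
    ext x
    have := exponentialPDF_eq 1 x
    unfold exponentialPDF exponentialPDFReal at this
    unfold gammaPDF
    rw [this]
    split_ifs <;> simp
  rw [this]
  exact isProbabilityMeasure_expMeasure one_pos

lemma exp_memLp : MemLp (fun x : ℝ => x) 2 expDist := by
  refine (memLp_two_iff_integrable_sq (by fun_prop)).2 ?_
  rw [expDist_integrable_iff]
  have := Real.GammaIntegral_convergent (s := 3) (by norm_num)
  refine this.congr_fun (fun x _ => ?_) measurableSet_Ioi
  simp only []
  rw [← Real.rpow_natCast]; norm_num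

lemma exp_mean : ∫ x : ℝ, x ∂expDist = 1 := by
  rw [expDist_integral]
  have h := Real.Gamma_eq_integral (s := 2) (by norm_num)
  rw [Real.Gamma_two] at h
  rw [h]
  refine setIntegral_congr_fun measurableSet_Ioi (fun x _ => ?_)
  norm_num

/-- **Almost sure limit of the split times** (Theorem 3.5(b) of
Bhamidi–van der Hofstad–Hooghiemstra): let `D₁, D₂, …` be i.i.d. Poisson(λ), `λ > 1`,
`S_i = Σ_{j≤i} D_j - (i-1)`, and let `E₁, E₂, …` be i.i.d. rate-1 exponential, independent of
the `D`'s.  On the survival event `{S_i > 0 ∀ i}` put `A_m = Σ_{i≤m} E_i/S_i` (the time of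
the `m`-th split of the continuous-time Poisson branching process, whose alive count after
the `m`-th split is `S_{m+1}`).  Then, a.s. on the survival event, `A_m - γ log m`
(`γ = 1/(λ-1)`) converges to the finite limit `-γ log(γ W_λ)`, where
`W_λ = lim_m e^{-(λ-1)A_m}·S_{m+1} > 0` is the a.s. limit of `e^{-(λ-1)t} N(t)` on
non-extinction. -/
theorem poisson_split_time_limit
    (lam : ℝ) (hlam : 1 < lam) (γ : ℝ) (hγ : γ = 1 / (lam - 1))
    (Ω : Type) [MeasurableSpace Ω] (μ : Measure Ω) [IsProbabilityMeasure μ]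
    -- `V i = (Dᵢ, Eᵢ)`: the Poisson offspring variable paired with an exponential lifetime
    (V : ℕ → Ω → ℕ × ℝ)
    (hmeas : ∀ i, Measurable (V i))
    (hindep : iIndepFun V μ)
    (hlaw : ∀ i, μ.map (V i) = (poissonDist lam).prod expDist)
    (S : ℕ → Ω → ℤ)
    (hS : ∀ j ω, S j ω = (∑ i ∈ Finset.Icc 1 j, ((V i ω).1 : ℤ)) - ((j : ℤ) - 1))
    (A : ℕ → Ω → ℝ)
    (hA : ∀ m ω, A m ω = ∑ i ∈ Finset.Icc 1 m, (V i ω).2 / ((S i ω : ℤ) : ℝ)) :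
    ∀ᵐ ω ∂μ, (∀ i : ℕ, 1 ≤ i → 0 < S i ω) →
      ∃ w : ℝ, 0 < w ∧
        Tendsto (fun m : ℕ => Real.exp (-(lam - 1) * A m ω) * ((S (m + 1) ω : ℤ) : ℝ))
          atTop (nhds w) ∧
        Tendsto (fun m : ℕ => A m ω - γ * Real.log m)
          atTop (nhds (-γ * Real.log (γ * w))) := by
  have hpois : poissonDist lam = poissonMeasure ⟨lam, by linarith⟩ := poissonDist_eq ⟨lam, _⟩
  rw [hpois] at hlaw
  set l : ℝ≥0 := ⟨lam, by linarith⟩ with hl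
  have hf : ∀ i, μ.map (fun ω => (V i ω).1) = poissonMeasure l := fun i => by
    have := Measure.map_map (μ := μ) (g := Prod.fst) measurable_fst (hmeas i)
    rw [hlaw, Measure.map_fst_prod, measure_univ, one_smul] at this
    exact this.symm
  have hg : ∀ i, μ.map (fun ω => (V i ω).2) = expDist := fun i => by
    have := Measure.map_map (μ := μ) (g := Prod.snd) measurable_snd (hmeas i)
    rw [hlaw, Measure.map_snd_prod, measure_univ, one_smul] at this
    exact this.symm
  have hind' : iIndepFun (fun i => V (i+1)) μ := hindep.precomp (add_left_injective 1)
  have hidV : ∀ i, IdentDistrib (V (i+1)) (V (0+1)) μ μ := fun i =>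
    ⟨(hmeas _).aemeasurable, (hmeas _).aemeasurable, by rw [hlaw, hlaw]⟩
  have mD : Measurable (fun p : ℕ × ℝ => (p.1 : ℝ)) := by fun_prop
  have mE : Measurable (fun p : ℕ × ℝ => p.2) := by fun_prop
  have hm1 : Measurable (fun ω => (V (0+1) ω).1) := (hmeas _).fst
  have hm2 : Measurable (fun ω => (V (0+1) ω).2) := (hmeas _).snd
  have PD := iid_part μ (fun i ω => ((V (i+1) ω).1 : ℝ))
    (by
      have := poisson_memLp l
      rw [← hf (0+1)] at this
      exact this.comp_of_map hm1.aemeasurable)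
    (hind'.comp (fun _ p => (p.1 : ℝ)) (fun _ => mD)) (fun i => (hidV i).comp mD) lam
    (by
      have := poisson_mean l
      rw [← hf (0+1), integral_map hm1.aemeasurable (by fun_prop)] at this
      exact this)
  have PE := iid_part μ (fun i ω => (V (i+1) ω).2)
    (by
      have := exp_memLp
      rw [← hg (0+1)] at this
      exact this.comp_of_map hm2.aemeasurable)
    (hind'.comp (fun _ p => p.2) (fun _ => mE)) (fun i => (hidV i).comp mE) 1
    (by
      have := exp_mean
      rw [← hg (0+1), integral_map hm2.aemeasurable (by fun_prop)] at this
      exact this)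
  have hIcc : ∀ (n : ℕ) (f : ℕ → ℝ),
      ∑ i ∈ Finset.Icc 1 n, f i = ∑ i ∈ Finset.range n, f (i+1) := by
    intro n f
    rw [Finset.range_eq_Ico, Finset.sum_Ico_add' f 0 n 1]
    rfl
  filter_upwards [PD, PE] with ω h1 h2 _
  subst hγ
  refine det_part lam hlam (fun i => ((V (i+1) ω).1 : ℝ)) (fun i => (V (i+1) ω).2)
    (fun n => ((S n ω : ℤ) : ℝ)) _ _ (fun n => A n ω) (fun n => rfl) (fun n => rfl)
    (fun n => ?_) (fun n => ?_) h1.1 h2.1 h1.2.1 h2.2.1 h1.2.2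
  · simp only [hS]
    push_cast
    rw [hIcc n (fun i => ((V i ω).1 : ℝ))]
  · simp only [hA]
    rw [hIcc n (fun i => (V i ω).2 / ((S i ω : ℤ) : ℝ))]

end
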